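/- Let φ, w be moduli of continuity and let ψ be a bilinear kernel on ℝⁿ × ℝⁿ × ℝⁿ satisfying the bilinear size and smoothness conditions with constant A. Let θ₁, θ₂ be integrable functions supported in cubes Q₁, Q₂ respectively, with ∫ θ₁ = ∫ θ₂ = 0. For x ∈ ℝⁿ and k = 1,2 define A^{(k)}(x) := ( [w]_Dini |x − c(Q_k)|^{−2n} φ( 2√n ℓ(Q_k)/|x − c(Q_k)| ) )^{1/2} and B^{(k)}(x) := ( ∫_{ℓ(Q_k)}^∞ |Q_k| (t + |x − c(Q_k)|)^{−2n} w( t/(t + |x − c(Q_k)|) ) dt/t^{n+1} )^{1/2}. Then for every x ∈ ℝⁿ ∖ (64nQ₁ ∪ 64nQ₂), ∬_{Γ₁(0)} | t^{−2n} ∫_{ℝ^{2n}} ψ( (x+z)/t, y₁/t, y₂/t ) θ₁(y₁)θ₂(y₂) dy₁ dy₂ | dz dt / t^{n+1} ≤ C ∏_{k=1}^{2} ( A^{(k)}(x) + B^{(k)}(x) ) ‖θ_k‖_{L¹}, where C depends only on n and A. -/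

import Mathlib

open MeasureTheory Set

noncomputable section

abbrev Eu (n : ℕ) : Type := EuclideanSpace ℝ (Fin n)

/-- A modulus of continuity: an increasing positive function on `(0,1]`,
extended by `w(t) = w(1)` for `t > 1`. -/
def IsMOC (w : ℝ → ℝ) : Prop :=
  (∀ t : ℝ, 0 < t → 0 < w t) ∧
  (∀ ⦃s t : ℝ⦄, 0 < s → s ≤ t → t ≤ 1 → w s ≤ w t) ∧
  (∀ t : ℝ, 1 ≤ t → w t = w 1)

/-- The Dini constant `[w]_Dini = ∫₀¹ w(t)/t dt + w(1)`. -/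
noncomputable def diniConst (w : ℝ → ℝ) : ℝ :=
  (∫ t in Set.Ioc (0 : ℝ) 1, w t / t) + w 1

/-- The Dini condition: `∫₀¹ w(t)/t dt < ∞`. -/
def SatisfiesDini (w : ℝ → ℝ) : Prop :=
  MeasureTheory.IntegrableOn (fun t => w t / t) (Set.Ioc (0 : ℝ) 1)

/-- the (closed, axis-parallel) cube with center `c` and side length `ℓ`. -/
def ccube (n : ℕ) (c : Eu n) (ℓ : ℝ) : Set (Eu n) := {y | ∀ i, |y i - c i| ≤ ℓ / 2}

/-- the bilinear size and smoothness conditions on the kernel `ψ` with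
constant `A` and moduli of continuity `φ`, `w`. -/
def BKernelCond (n : ℕ) (A : ℝ) (ψ : Eu n → Eu n → Eu n → ℝ) (φ w : ℝ → ℝ) : Prop :=
  (∀ x y₁ y₂ : Eu n,
    |ψ x y₁ y₂| ≤ A / (1 + ‖x - y₁‖ + ‖x - y₂‖) ^ (2 * n) *
      w (1 / (1 + ‖x - y₁‖ + ‖x - y₂‖))) ∧
  (∀ x x' y₁ y₂ : Eu n, ‖x - x'‖ < max ‖x - y₁‖ ‖x - y₂‖ / 2 →
    |ψ x y₁ y₂ - ψ x' y₁ y₂| ≤ A / (1 + ‖x - y₁‖ + ‖x - y₂‖) ^ (2 * n) *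
      w (1 / (1 + ‖x - y₁‖ + ‖x - y₂‖)) *
      φ (‖x - x'‖ / (1 + ‖x - y₁‖ + ‖x - y₂‖))) ∧
  (∀ x y₁ y₁' y₂ : Eu n, ‖y₁ - y₁'‖ < max ‖x - y₁‖ ‖x - y₂‖ / 2 →
    |ψ x y₁ y₂ - ψ x y₁' y₂| ≤ A / (1 + ‖x - y₁‖ + ‖x - y₂‖) ^ (2 * n) *
      w (1 / (1 + ‖x - y₁‖ + ‖x - y₂‖)) *
      φ (‖y₁ - y₁'‖ / (1 + ‖x - y₁‖ + ‖x - y₂‖))) ∧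
  (∀ x y₁ y₂ y₂' : Eu n, ‖y₂ - y₂'‖ < max ‖x - y₁‖ ‖x - y₂‖ / 2 →
    |ψ x y₁ y₂ - ψ x y₁ y₂'| ≤ A / (1 + ‖x - y₁‖ + ‖x - y₂‖) ^ (2 * n) *
      w (1 / (1 + ‖x - y₁‖ + ‖x - y₂‖)) *
      φ (‖y₂ - y₂'‖ / (1 + ‖x - y₁‖ + ‖x - y₂‖)))

lemma IsMOC.mono {w : ℝ → ℝ} (hw : IsMOC w) {s t : ℝ} (hs : 0 < s) (hst : s ≤ t) :
    w s ≤ w t := by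
  rcases le_total t 1 with h | h
  · exact hw.2.1 hs hst h
  · rw [hw.2.2 t h]
    rcases le_total s 1 with h' | h'
    · exact hw.2.1 hs h' le_rfl
    · rw [hw.2.2 s h']

lemma IsMOC.diniConst_pos {w : ℝ → ℝ} (hw : IsMOC w) : 0 < diniConst w :=
  add_pos_of_nonneg_of_pos
    (setIntegral_nonneg measurableSet_Ioc fun t ht => (div_pos (hw.1 t ht.1) ht.1).le)
    (hw.1 1 one_pos)

lemma BKernelCond.nonneg {n : ℕ} {A : ℝ} {ψ : Eu n → Eu n → Eu n → ℝ} {φ w : ℝ → ℝ}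
    (hψ : BKernelCond n A ψ φ w) (hw : IsMOC w) : 0 ≤ A := by
  have h := (abs_nonneg _).trans (hψ.1 0 0 0)
  have h1 := hw.1 1 one_pos
  simp only [sub_self, norm_zero, add_zero, one_pow, div_one] at h
  exact nonneg_of_mul_nonneg_left h h1

lemma BKernelCond.swap {n : ℕ} {A : ℝ} {ψ : Eu n → Eu n → Eu n → ℝ} {φ w : ℝ → ℝ}
    (hψ : BKernelCond n A ψ φ w) : BKernelCond n A (fun x y₁ y₂ => ψ x y₂ y₁) φ w := by
  obtain ⟨h1, h2, h3, h4⟩ := hψ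
  refine ⟨fun x y₁ y₂ => ?_, fun x x' y₁ y₂ h => ?_, fun x y₁ y₁' y₂ h => ?_,
    fun x y₁ y₂ y₂' h => ?_⟩
  · simpa only [add_right_comm] using h1 x y₂ y₁
  · simpa only [add_right_comm] using h2 x x' y₂ y₁ (by rwa [max_comm])
  · simpa only [add_right_comm] using h4 x y₂ y₁ y₁' (by rwa [max_comm])
  · simpa only [add_right_comm] using h3 x y₂ y₂' y₁ (by rwa [max_comm])

/-- The smoothness condition in the second variable, after rescaling by `t`. -/
lemma BKernelCond.abs_sub_le {n : ℕ} {A : ℝ} {ψ : Eu n → Eu n → Eu n → ℝ} {φ w : ℝ → ℝ}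
    (hψ : BKernelCond n A ψ φ w) (hφ : IsMOC φ) (hw : IsMOC w) {t ρ s : ℝ} (ht : 0 < t)
    (hρ : 0 < ρ) (hs : 0 < s) {u y y' v : Eu n} (hsmall : ‖y - y'‖ < max ‖u - y‖ ‖u - v‖ / 2)
    (hD : ρ ≤ t + ‖u - y‖ + ‖u - v‖) (hsD : ‖y - y'‖ ≤ s * (t + ‖u - y‖ + ‖u - v‖)) :
    |ψ (t⁻¹ • u) (t⁻¹ • y) (t⁻¹ • v) - ψ (t⁻¹ • u) (t⁻¹ • y') (t⁻¹ • v)| ≤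
      A * (t / ρ) ^ (2 * n) * w (t / ρ) * φ s := by
  have hA := hψ.nonneg hw
  have hφs := hφ.1 s hs
  have hwρ := hw.1 (t / ρ) (by positivity)
  rcases eq_or_ne y y' with rfl | hne
  · simp only [sub_self, abs_zero]
    positivity
  have hsc : ∀ a b : Eu n, ‖t⁻¹ • a - t⁻¹ • b‖ = t⁻¹ * ‖a - b‖ := fun a b => by
    rw [← smul_sub, norm_smul, Real.norm_of_nonneg (by positivity)]
  have h := hψ.2.2.1 (t⁻¹ • u) (t⁻¹ • y) (t⁻¹ • y') (t⁻¹ • v) (by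
    rw [hsc, hsc, hsc, ← mul_max_of_nonneg _ _ (by positivity), mul_div_assoc]
    gcongr)
  rw [hsc, hsc, hsc] at h
  set D := t + ‖u - y‖ + ‖u - v‖ with hDdef
  have hDpos : 0 < D := hρ.trans_le hD
  have e : 1 + t⁻¹ * ‖u - y‖ + t⁻¹ * ‖u - v‖ = D / t := by
    rw [hDdef]; field_simp
  have hny : 0 < ‖y - y'‖ := norm_pos_iff.2 (sub_ne_zero.2 hne)
  have e1 : A / (D / t) ^ (2 * n) = A * (t / D) ^ (2 * n) := by
    rw [div_pow, div_pow]; field_simp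
  have e2 : t⁻¹ * ‖y - y'‖ / (D / t) = ‖y - y'‖ / D := by field_simp
  rw [e, one_div_div, e1, e2] at h
  have hwD := hw.1 (t / D) (by positivity)
  have hφD := hφ.1 (‖y - y'‖ / D) (by positivity)
  have m1 : w (t / D) ≤ w (t / ρ) := hw.mono (by positivity) (by gcongr)
  have m2 : φ (‖y - y'‖ / D) ≤ φ s := hφ.mono (by positivity) ((div_le_iff₀ hDpos).2 hsD)
  refine h.trans ?_
  gcongr

/-- Moving `y` towards `u` in geometrically decreasing steps. -/
lemma BKernelCond.abs_sub_self_le {n : ℕ} {A : ℝ} {ψ : Eu n → Eu n → Eu n → ℝ} {φ w : ℝ → ℝ}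
    (hψ : BKernelCond n A ψ φ w) (hφ : IsMOC φ) (hw : IsMOC w) {t s m : ℝ} (ht : 0 < t)
    (hs : 0 < s) (hmt : 6 / 5 * m ≤ s * t) {u v : Eu n} (N : ℕ) :
    ∀ y : Eu n, ‖u - y‖ ≤ 3 * m → (3 / 5) ^ N * ‖u - y‖ < ‖u - v‖ / 2 →
      (3 / 5) ^ N * ‖u - y‖ ≤ m →
      |ψ (t⁻¹ • u) (t⁻¹ • y) (t⁻¹ • v) - ψ (t⁻¹ • u) (t⁻¹ • u) (t⁻¹ • v)| ≤
        (N + 1) * (A * w 1 * φ s) := by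
  have key : ∀ y y' : Eu n, ‖y - y'‖ < max ‖u - y‖ ‖u - v‖ / 2 → ‖y - y'‖ ≤ 6 / 5 * m →
      |ψ (t⁻¹ • u) (t⁻¹ • y) (t⁻¹ • v) - ψ (t⁻¹ • u) (t⁻¹ • y') (t⁻¹ • v)| ≤
        A * w 1 * φ s := by
    intro y y' h1 h2
    have ha := norm_nonneg (u - y)
    have hb := norm_nonneg (u - v)
    have := hψ.abs_sub_le hφ hw ht ht hs h1 (by linarith)
      ((h2.trans hmt).trans (by gcongr; linarith))
    simpa [div_self ht.ne'] using this
  have hM : 0 ≤ A * w 1 * φ s :=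
    mul_nonneg (mul_nonneg (hψ.nonneg hw) (hw.1 1 one_pos).le) (hφ.1 s hs).le
  induction N with
  | zero =>
    intro y h1 h2 h3
    simp only [pow_zero, one_mul, Nat.cast_zero, zero_add] at *
    have hm : 0 ≤ m := (norm_nonneg _).trans h3
    refine key y u ?_ ?_
    · rw [norm_sub_rev]
      exact h2.trans_le (by gcongr; exact le_max_right _ _)
    · rw [norm_sub_rev]; linarith
  | succ N ih =>
    intro y h1 h2 h3
    have hn := norm_nonneg (u - y)
    rcases hn.eq_or_lt with h0 | h0
    · have : y = u := by
        have := norm_eq_zero.1 h0.symm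
        exact (sub_eq_zero.1 this).symm
      rw [this, sub_self, abs_zero]
      positivity
    set y' : Eu n := u - (3 / 5 : ℝ) • (u - y) with hy'
    have e1 : ‖u - y'‖ = 3 / 5 * ‖u - y‖ := by
      rw [hy', sub_sub_cancel, norm_smul, Real.norm_of_nonneg (by norm_num)]
    have e2 : ‖y - y'‖ = 2 / 5 * ‖u - y‖ := by
      rw [hy', show y - (u - (3 / 5 : ℝ) • (u - y)) = -((2 / 5 : ℝ) • (u - y)) by module,
        norm_neg, norm_smul, Real.norm_of_nonneg (by norm_num)]
    have a1 := key y y' (by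
      rw [e2]
      have := le_max_left ‖u - y‖ ‖u - v‖
      linarith) (by rw [e2]; linarith)
    have a2 := ih y' (by rw [e1]; linarith) (by rw [e1, ← mul_assoc, ← pow_succ]; exact h2)
      (by rw [e1, ← mul_assoc, ← pow_succ]; exact h3)
    have := _root_.abs_sub_le (ψ (t⁻¹ • u) (t⁻¹ • y) (t⁻¹ • v)) (ψ (t⁻¹ • u) (t⁻¹ • y') (t⁻¹ • v))
      (ψ (t⁻¹ • u) (t⁻¹ • u) (t⁻¹ • v))
    push_cast
    linarith

/-- A function dominating the number of steps needed to connect two points of scale `m` in the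
second variable of the kernel, in terms of the displacement `d` of the third variable. -/
def stepCount {n : ℕ} (m : ℝ) (d : Eu n) : ENNReal :=
  8 + 2 * ∑' j : ℕ, (Metric.closedBall (0 : Eu n) (6 * m * (3 / 5) ^ j)).indicator 1 d

lemma measurable_stepCount {n : ℕ} (m : ℝ) : Measurable (stepCount (n := n) m) := by
  refine measurable_const.add (measurable_const.mul (Measurable.tsum (f := fun j : ℕ =>
    (Metric.closedBall (0 : Eu n) (6 * m * (3 / 5) ^ j)).indicator (1 : Eu n → ENNReal))
    fun j => ?_))
  exact measurable_one.indicator Metric.isClosed_closedBall.measurableSet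

lemma one_le_stepCount {n : ℕ} (m : ℝ) (d : Eu n) : 1 ≤ stepCount m d :=
  le_add_right (by norm_num)

lemma stepCount_zero {n : ℕ} {m : ℝ} (hm : 0 < m) : stepCount m (0 : Eu n) = ⊤ := by
  have h : ∀ j : ℕ, (Metric.closedBall (0 : Eu n) (6 * m * (3 / 5) ^ j)).indicator
      (1 : Eu n → ENNReal) 0 = 1 := fun j =>
    indicator_of_mem (Metric.mem_closedBall_self (by positivity)) _
  simp [stepCount, h]

lemma exists_nat_le_stepCount {n : ℕ} {m : ℝ} (hm : 0 < m) {d : Eu n} (hd : d ≠ 0) :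
    ∃ N : ℕ, (3 / 5) ^ N * (3 * m) < ‖d‖ / 2 ∧ ((2 * (N + 4) : ℕ) : ENNReal) ≤ stepCount m d := by
  have hd' : 0 < ‖d‖ := norm_pos_iff.2 hd
  have hex : ∃ N : ℕ, (3 / 5 : ℝ) ^ N * (3 * m) < ‖d‖ / 2 := by
    obtain ⟨N, hN⟩ := exists_pow_lt_of_lt_one (show 0 < ‖d‖ / 2 / (3 * m) by positivity)
      (show (3 / 5 : ℝ) < 1 by norm_num)
    exact ⟨N, (lt_div_iff₀ (by positivity)).1 hN⟩
  classical
  refine ⟨Nat.find hex, Nat.find_spec hex, ?_⟩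
  have h : ((Nat.find hex : ℕ) : ENNReal) ≤
      ∑' j : ℕ, (Metric.closedBall (0 : Eu n) (6 * m * (3 / 5) ^ j)).indicator 1 d := by
    calc ((Nat.find hex : ℕ) : ENNReal) = ∑ j ∈ Finset.range (Nat.find hex), 1 := by simp
      _ ≤ ∑ j ∈ Finset.range (Nat.find hex),
          (Metric.closedBall (0 : Eu n) (6 * m * (3 / 5) ^ j)).indicator 1 d := by
        refine Finset.sum_le_sum fun j hj => ?_
        have := Nat.find_min hex (Finset.mem_range.1 hj)
        rw [indicator_of_mem]
        · simp
        · rw [mem_closedBall_zero_iff]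
          linarith
      _ ≤ _ := ENNReal.sum_le_tsum _
  rw [stepCount]
  push_cast
  rw [mul_add, add_comm]
  gcongr
  norm_num

lemma BKernelCond.enorm_sub_le_stepCount {n : ℕ} {A : ℝ} {ψ : Eu n → Eu n → Eu n → ℝ}
    {φ w : ℝ → ℝ} (hψ : BKernelCond n A ψ φ w) (hφ : IsMOC φ) (hw : IsMOC w) {t s m : ℝ}
    (ht : 0 < t) (hs : 0 < s) (hm : 0 < m) (hmt : 6 / 5 * m ≤ s * t) {u y y' : Eu n} (v : Eu n)
    (hy : ‖u - y‖ ≤ 3 * m) (hy' : ‖u - y'‖ ≤ 3 * m) :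
    ‖ψ (t⁻¹ • u) (t⁻¹ • y) (t⁻¹ • v) - ψ (t⁻¹ • u) (t⁻¹ • y') (t⁻¹ • v)‖ₑ ≤
      ENNReal.ofReal ((A + 1) * w 1 * φ s) * stepCount m (u - v) := by
  have hA := hψ.nonneg hw
  have hφs := hφ.1 s hs
  have hw1 := hw.1 1 one_pos
  rcases eq_or_ne (u - v) 0 with h0 | h0
  · rw [h0, stepCount_zero hm, ENNReal.mul_top]
    · exact le_top
    · rw [Ne, ENNReal.ofReal_eq_zero, not_le]
      positivity
  obtain ⟨N, hN, hNc⟩ := exists_nat_le_stepCount hm h0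
  have hpow : ((3 : ℝ) / 5) ^ (N + 3) ≤ (3 / 5) ^ N :=
    pow_le_pow_of_le_one (by norm_num) (by norm_num) (by omega)
  have hpow3 : ((3 : ℝ) / 5) ^ (N + 3) ≤ (3 / 5) ^ 3 :=
    pow_le_pow_of_le_one (by norm_num) (by norm_num) (by omega)
  have key : ∀ z : Eu n, ‖u - z‖ ≤ 3 * m →
      |ψ (t⁻¹ • u) (t⁻¹ • z) (t⁻¹ • v) - ψ (t⁻¹ • u) (t⁻¹ • u) (t⁻¹ • v)| ≤
        (N + 4) * (A * w 1 * φ s) := by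
    intro z hz
    have h := hψ.abs_sub_self_le hφ hw ht hs hmt (v := v) (N + 3) z hz
      ((mul_le_mul hpow hz (norm_nonneg _) (by positivity)).trans_lt hN)
      ((mul_le_mul hpow3 hz (norm_nonneg _) (by positivity)).trans (by linarith))
    refine h.trans (le_of_eq ?_)
    push_cast
    ring
  have h1 := key y hy
  have h2 := key y' hy'
  rw [abs_sub_comm] at h2
  have h3 := _root_.abs_sub_le (ψ (t⁻¹ • u) (t⁻¹ • y) (t⁻¹ • v))
    (ψ (t⁻¹ • u) (t⁻¹ • u) (t⁻¹ • v)) (ψ (t⁻¹ • u) (t⁻¹ • y') (t⁻¹ • v))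
  have hM : A * w 1 * φ s ≤ (A + 1) * w 1 * φ s := by gcongr; linarith
  rw [Real.enorm_eq_ofReal_abs]
  calc _ ≤ ENNReal.ofReal ((A + 1) * w 1 * φ s * ((2 * (N + 4) : ℕ) : ℝ)) := by
        apply ENNReal.ofReal_le_ofReal
        push_cast
        nlinarith
    _ = ENNReal.ofReal ((A + 1) * w 1 * φ s) * ((2 * (N + 4) : ℕ) : ENNReal) := by
        rw [ENNReal.ofReal_mul (by positivity), ENNReal.ofReal_natCast]
    _ ≤ _ := by gcongr

/-- Large scales: `t ≥ R / 4`. -/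
lemma BKernelCond.enorm_sub_le_of_large {n : ℕ} {A : ℝ} {ψ : Eu n → Eu n → Eu n → ℝ}
    {φ w : ℝ → ℝ} (hψ : BKernelCond n A ψ φ w) (hφ : IsMOC φ) (hw : IsMOC w) {t m : ℝ}
    {x c u y y' : Eu n} (hm : 0 < m) (hR : 32 * m ≤ ‖x - c‖) (ht : ‖x - c‖ / 4 ≤ t)
    (hu : ‖u - x‖ < t) (hy : ‖y - c‖ ≤ m / 2) (hy' : ‖y' - c‖ ≤ m / 2) (v : Eu n) :
    ‖ψ (t⁻¹ • u) (t⁻¹ • y) (t⁻¹ • v) - ψ (t⁻¹ • u) (t⁻¹ • y') (t⁻¹ • v)‖ₑ ≤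
      ENNReal.ofReal ((A + 1) * w 1 * φ (2 * m / ‖x - c‖)) * stepCount m (u - v) := by
  set R := ‖x - c‖ with hRdef
  have hRpos : 0 < R := by linarith
  have htpos : 0 < t := by linarith
  have hA := hψ.nonneg hw
  have hs : 0 < 2 * m / R := by positivity
  have hφs := hφ.1 _ hs
  have hw1 := hw.1 1 one_pos
  have hyy : ‖y - y'‖ ≤ m := by
    have := norm_sub_le_norm_sub_add_norm_sub y c y'
    rw [norm_sub_rev c y'] at this
    linarith
  have hux : R ≤ ‖u - x‖ + ‖u - y‖ + ‖y - c‖ := by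
    have h1 := norm_sub_le_norm_sub_add_norm_sub x u c
    have h2 := norm_sub_le_norm_sub_add_norm_sub u y c
    rw [norm_sub_rev x u] at h1
    linarith
  rcases le_or_gt ‖u - y‖ (2 * m) with h | h
  · refine hψ.enorm_sub_le_stepCount hφ hw htpos hs hm ?_ v (by linarith) ?_
    · rw [div_mul_eq_mul_div (2 * m), le_div_iff₀ hRpos]
      nlinarith
    · have := norm_sub_le_norm_sub_add_norm_sub u y y'
      linarith
  · have hb := norm_nonneg (u - v)
    have h1 := hψ.abs_sub_le hφ hw htpos htpos hs (u := u) (y := y) (y' := y') (v := v)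
      (by have := le_max_left ‖u - y‖ ‖u - v‖; linarith) (by linarith)
      (hyy.trans (by
        rw [div_mul_eq_mul_div, le_div_iff₀ hRpos]
        nlinarith))
    rw [div_self htpos.ne', one_pow, mul_one] at h1
    rw [Real.enorm_eq_ofReal_abs]
    calc _ ≤ ENNReal.ofReal ((A + 1) * w 1 * φ (2 * m / R)) * 1 := by
          rw [mul_one]
          refine ENNReal.ofReal_le_ofReal (h1.trans ?_)
          gcongr
          linarith
      _ ≤ _ := by gcongr; exact one_le_stepCount _ _

/-- Small scales: `t < R / 4`. -/
lemma BKernelCond.enorm_sub_le_of_small {n : ℕ} {A : ℝ} {ψ : Eu n → Eu n → Eu n → ℝ}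
    {φ w : ℝ → ℝ} (hψ : BKernelCond n A ψ φ w) (hφ : IsMOC φ) (hw : IsMOC w) {t m : ℝ}
    {x c u y y' : Eu n} (hm : 0 < m) (hR : 32 * m ≤ ‖x - c‖) (ht : t < ‖x - c‖ / 4)
    (hu : ‖u - x‖ < t) (hy : ‖y - c‖ ≤ m / 2) (hy' : ‖y' - c‖ ≤ m / 2) (v : Eu n) :
    ‖ψ (t⁻¹ • u) (t⁻¹ • y) (t⁻¹ • v) - ψ (t⁻¹ • u) (t⁻¹ • y') (t⁻¹ • v)‖ₑ ≤
      ENNReal.ofReal (A * (t / (‖x - c‖ / 2)) ^ (2 * n) * w (t / (‖x - c‖ / 2)) *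
        φ (2 * m / ‖x - c‖)) := by
  set R := ‖x - c‖ with hRdef
  have hRpos : 0 < R := by linarith
  have htpos : 0 < t := (norm_nonneg _).trans_lt hu
  have hs : 0 < 2 * m / R := by positivity
  have hyy : ‖y - y'‖ ≤ m := by
    have := norm_sub_le_norm_sub_add_norm_sub y c y'
    rw [norm_sub_rev c y'] at this
    linarith
  have hux : R ≤ ‖u - x‖ + ‖u - y‖ + ‖y - c‖ := by
    have h1 := norm_sub_le_norm_sub_add_norm_sub x u c
    have h2 := norm_sub_le_norm_sub_add_norm_sub u y c
    rw [norm_sub_rev x u] at h1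
    linarith
  have hb := norm_nonneg (u - v)
  rw [Real.enorm_eq_ofReal_abs]
  refine ENNReal.ofReal_le_ofReal (hψ.abs_sub_le hφ hw htpos (by positivity) hs ?_ ?_ ?_)
  · have := le_max_left ‖u - y‖ ‖u - v‖
    linarith
  · linarith
  · refine hyy.trans ?_
    rw [div_mul_eq_mul_div, le_div_iff₀ hRpos]
    nlinarith

/-- Cancellation in the first variable of a bilinear form. -/
lemma enorm_integral_le_of_cancel {n : ℕ} {k : Eu n → Eu n → ℝ} {θ₁ θ₂ : Eu n → ℝ}
    (hθ : Integrable θ₁) (hmean : ∫ y, θ₁ y = 0) {S : Set (Eu n)} (hS : ∀ y ∉ S, θ₁ y = 0)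
    {E : Eu n → ENNReal} (hE : ∀ y ∈ S, ∀ y' ∈ S, ∀ v, ‖k y v - k y' v‖ₑ ≤ E v) :
    ‖∫ y : Eu n × Eu n, k y.1 y.2 * θ₁ y.1 * θ₂ y.2‖ₑ ≤
      (∫⁻ y, ‖θ₁ y‖ₑ) * ∫⁻ v, E v * ‖θ₂ v‖ₑ := by
  by_cases hf : Integrable (fun y : Eu n × Eu n => k y.1 y.2 * θ₁ y.1 * θ₂ y.2)
  swap
  · rw [integral_undef hf]; simp
  have hf' : Integrable (fun y : Eu n × Eu n => k y.1 y.2 * θ₁ y.1 * θ₂ y.2)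
    ((volume : Measure (Eu n)).prod volume) := hf
  have hae := hf'.prod_right_ae
  have hI : ∫ y : Eu n × Eu n, k y.1 y.2 * θ₁ y.1 * θ₂ y.2 =
      ∫ y, ∫ v, k y v * θ₁ y * θ₂ v := integral_prod _ hf'
  by_cases hz : ∃ y₀, θ₁ y₀ ≠ 0 ∧ Integrable (fun v => k y₀ v * θ₁ y₀ * θ₂ v)
  swap
  · push Not at hz
    have : ∫ y, ∫ v, k y v * θ₁ y * θ₂ v = ∫ y : Eu n, (0 : ℝ) := by
      refine integral_congr_ae ?_
      filter_upwards [hae] with y hy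
      have h0 : θ₁ y = 0 := by
        by_contra h
        exact hz y h hy
      simp [h0]
    rw [hI, this]
    simp
  obtain ⟨y₀, hy₀, hki₀⟩ := hz
  have hy₀S : y₀ ∈ S := by
    by_contra h
    exact hy₀ (hS _ h)
  have hki : Integrable (fun v => k y₀ v * θ₂ v) := by
    refine (hki₀.const_mul (θ₁ y₀)⁻¹).congr (Filter.Eventually.of_forall fun v => ?_)
    field_simp
  have hsub : ∫ y, ∫ v, k y v * θ₁ y * θ₂ v =
      ∫ y, ((∫ v, k y v * θ₁ y * θ₂ v) - θ₁ y * ∫ v, k y₀ v * θ₂ v) := by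
    rw [integral_sub hf'.integral_prod_left (hθ.mul_const _), integral_mul_const, hmean]
    simp
  rw [hI, hsub]
  refine (enorm_integral_le_lintegral_enorm _).trans ?_
  rw [← lintegral_mul_const'' _ hθ.aestronglyMeasurable.enorm]
  refine lintegral_mono_ae ?_
  filter_upwards [hae] with y hy
  by_cases hyS : y ∈ S
  swap
  · simp [hS y hyS]
  have e : (∫ v, k y v * θ₁ y * θ₂ v) - θ₁ y * ∫ v, k y₀ v * θ₂ v =
      ∫ v, θ₁ y * ((k y v - k y₀ v) * θ₂ v) := by
    rw [← integral_const_mul, ← integral_sub hy (hki.const_mul _)]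
    congr 1 with v
    ring
  rw [e, integral_const_mul, enorm_mul]
  gcongr
  refine (enorm_integral_le_lintegral_enorm _).trans (lintegral_mono fun v => ?_)
  rw [enorm_mul]
  gcongr
  exact hE y hyS y₀ hy₀S v

lemma lintegral_cone_le {n : ℕ} (F : Eu n × ℝ → ENNReal) :
    ∫⁻ p in {p : Eu n × ℝ | ‖p.1‖ < p.2}, F p ≤
      ∫⁻ t in Ioi (0 : ℝ), ∫⁻ z in Metric.ball (0 : Eu n) t, F (z, t) := by
  have hS : MeasurableSet {p : Eu n × ℝ | ‖p.1‖ < p.2} :=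
    measurableSet_lt measurable_fst.norm measurable_snd
  rw [← lintegral_indicator hS, ← lintegral_indicator measurableSet_Ioi, Measure.volume_eq_prod,
    ← lintegral_prod_swap]
  refine (lintegral_prod_le _).trans (lintegral_mono fun t => ?_)
  by_cases ht : t ∈ Ioi (0 : ℝ)
  · rw [indicator_of_mem ht, ← lintegral_indicator Metric.isOpen_ball.measurableSet]
    refine le_of_eq (lintegral_congr fun z => ?_)
    simp [indicator, Metric.mem_ball]
  · rw [indicator_of_notMem ht]
    refine le_of_eq ((lintegral_congr fun z => ?_).trans lintegral_zero)
    rw [indicator_of_notMem]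
    simp only [mem_Ioi, not_lt, mem_ofPred_eq, Prod.fst_swap, Prod.snd_swap] at *
    exact ht.trans (norm_nonneg z)

lemma volume_ball_eq {n : ℕ} (hn : 1 ≤ n) {t : ℝ} (ht : 0 ≤ t) :
    volume (Metric.ball (0 : Eu n) t) =
      ENNReal.ofReal (t ^ n) * volume (Metric.ball (0 : Eu n) 1) := by
  have : Nonempty (Fin n) := ⟨⟨0, hn⟩⟩
  rw [Measure.addHaar_ball _ _ ht]
  simp

lemma lintegral_stepCount_le {n : ℕ} (hn : 1 ≤ n) {m t : ℝ} (hm : 0 < m) (hmt : 6 * m ≤ t)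
    (x v : Eu n) :
    ∫⁻ z in Metric.ball (0 : Eu n) t, stepCount m (x + z - v) ≤
      ENNReal.ofReal (13 * t ^ n) * volume (Metric.ball (0 : Eu n) 1) := by
  have ht : 0 < t := by linarith
  set V := volume (Metric.ball (0 : Eu n) 1)
  have hmeas : ∀ j : ℕ, Measurable fun z : Eu n =>
      (Metric.closedBall (0 : Eu n) (6 * m * (3 / 5) ^ j)).indicator (1 : Eu n → ENNReal)
        (x + z - v) := fun j =>
    (measurable_one.indicator Metric.isClosed_closedBall.measurableSet).comp (by fun_prop)
  have hball : ∀ j : ℕ, ∫⁻ z in Metric.ball (0 : Eu n) t,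
      (Metric.closedBall (0 : Eu n) (6 * m * (3 / 5) ^ j)).indicator (1 : Eu n → ENNReal)
        (x + z - v) ≤ ENNReal.ofReal (t ^ n * (3 / 5) ^ j) * V := by
    intro j
    refine (setLIntegral_le_lintegral _ _).trans ?_
    have e : ∀ z : Eu n, x + z - v = z + (x - v) := fun z => by abel
    simp_rw [e]
    rw [lintegral_add_right_eq_self (fun z => (Metric.closedBall (0 : Eu n)
      (6 * m * (3 / 5) ^ j)).indicator (1 : Eu n → ENNReal) z) (x - v),
      lintegral_indicator_one Metric.isClosed_closedBall.measurableSet,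
      Measure.addHaar_closedBall _ _ (by positivity), finrank_euclideanSpace_fin]
    gcongr
    rw [mul_pow]
    gcongr
    exact pow_le_of_le_one (by positivity) (pow_le_one₀ (by norm_num) (by norm_num)) (by omega)
  have hsum : ∑' j : ℕ, ENNReal.ofReal (t ^ n * (3 / 5) ^ j) * V =
      ENNReal.ofReal (5 / 2 * t ^ n) * V := by
    have hs : Summable fun j : ℕ => ((3 : ℝ) / 5) ^ j :=
      summable_geometric_of_lt_one (by norm_num) (by norm_num)
    rw [ENNReal.tsum_mul_right, ← ENNReal.ofReal_tsum_of_nonneg (fun j => by positivity)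
      (hs.mul_left _), tsum_mul_left, tsum_geometric_of_lt_one (by norm_num) (by norm_num)]
    congr 2
    ring
  unfold stepCount
  rw [lintegral_add_left measurable_const, lintegral_const_mul _ (Measurable.tsum hmeas),
    lintegral_tsum fun j => (hmeas j).aemeasurable, setLIntegral_const, volume_ball_eq hn ht.le]
  calc _ ≤ 8 * (ENNReal.ofReal (t ^ n) * V) +
        2 * ∑' j : ℕ, ENNReal.ofReal (t ^ n * (3 / 5) ^ j) * V := by
        gcongr with j
        exact hball j
    _ = _ := by
      rw [hsum, show (8 : ENNReal) = ENNReal.ofReal 8 by simp,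
        show (2 : ENNReal) = ENNReal.ofReal 2 by simp, ← mul_assoc, ← mul_assoc,
        ← ENNReal.ofReal_mul (by norm_num), ← ENNReal.ofReal_mul (by norm_num), ← add_mul,
        ← ENNReal.ofReal_add (by positivity) (by positivity)]
      congr 2
      ring

lemma lintegral_dini_le {w : ℝ → ℝ} (hw : IsMOC w) (hd : SatisfiesDini w) {R : ℝ} (hR : 0 < R) :
    ∫⁻ t in Ioo 0 (R / 4), ENNReal.ofReal (w (t / (R / 2)) / t) ≤
      ENNReal.ofReal (diniConst w) := by
  have hki : IntervalIntegrable (fun t => w t / t) volume 0 1 :=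
    (intervalIntegrable_iff_integrableOn_Ioc_of_le zero_le_one).2 hd
  have hpt : ∀ t : ℝ, w (t / (R / 2)) / t = (2 / R) * (w (2 / R * t) / (2 / R * t)) := by
    intro t
    rw [show t / (R / 2) = 2 / R * t by field_simp]
    field_simp
  have h1 : IntervalIntegrable (fun t => (2 / R) * (w (2 / R * t) / (2 / R * t))) volume
      0 (R / 2) := by
    have := (hki.comp_mul_left (c := 2 / R)).const_mul (2 / R)
    simpa using this
  have h2 : ∫ t in (0 : ℝ)..(R / 2), (2 / R) * (w (2 / R * t) / (2 / R * t)) =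
      ∫ t in (0 : ℝ)..1, w t / t := by
    rw [intervalIntegral.integral_const_mul,
      intervalIntegral.integral_comp_mul_left (fun t => w t / t) (by positivity)]
    have e : 2 / R * (R / 2) = 1 := by field_simp
    rw [e, mul_zero, smul_eq_mul, mul_inv_cancel_left₀ (by positivity)]
  have hR2 : (0 : ℝ) ≤ R / 2 := by positivity
  have h3 := (intervalIntegrable_iff_integrableOn_Ioc_of_le hR2).1 h1
  simp_rw [hpt]
  calc _ ≤ ∫⁻ t in Ioc 0 (R / 2), ENNReal.ofReal ((2 / R) * (w (2 / R * t) / (2 / R * t))) :=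
        lintegral_mono_set fun t ht => ⟨ht.1, by linarith [ht.2]⟩
    _ = ENNReal.ofReal (∫ t in Ioc 0 (R / 2), (2 / R) * (w (2 / R * t) / (2 / R * t))) := by
        rw [ofReal_integral_eq_lintegral_ofReal h3]
        refine (ae_restrict_iff' measurableSet_Ioc).2 (Filter.Eventually.of_forall fun t ht => ?_)
        have ht0 : 0 < 2 / R * t := mul_pos (by positivity) ht.1
        have := hw.1 _ ht0
        simp only [Pi.zero_apply]
        positivity
    _ ≤ _ := by
        rw [← intervalIntegral.integral_of_le hR2, h2, intervalIntegral.integral_of_le zero_le_one]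
        exact ENNReal.ofReal_le_ofReal (le_add_of_nonneg_right (hw.1 1 one_pos).le)

lemma lintegral_Ici_inv_pow_le {k : ℕ} (hk : 1 ≤ k) {r : ℝ} (hr : 0 < r) :
    ∫⁻ t in Ici r, ENNReal.ofReal ((t ^ (k + 1))⁻¹) ≤ ENNReal.ofReal ((r⁻¹) ^ k) := by
  have hk' : (1 : ℝ) ≤ k := by exact_mod_cast hk
  have ha : -((k : ℝ) + 1) < -1 := by linarith
  have hi := integrableOn_Ioi_rpow_of_lt ha hr
  rw [setLIntegral_congr Ioi_ae_eq_Ici.symm]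
  have e : ∫⁻ t in Ioi r, ENNReal.ofReal ((t ^ (k + 1))⁻¹) =
      ∫⁻ t in Ioi r, ENNReal.ofReal (t ^ (-((k : ℝ) + 1))) := by
    refine setLIntegral_congr_fun measurableSet_Ioi fun t ht => ?_
    have ht0 : 0 < t := hr.trans ht
    rw [Real.rpow_neg ht0.le]
    norm_cast
  rw [e, ← ofReal_integral_eq_lintegral_ofReal hi]
  · rw [integral_Ioi_rpow_of_lt ha hr]
    refine ENNReal.ofReal_le_ofReal ?_
    rw [show -((k : ℝ) + 1) + 1 = -(k : ℝ) by ring, Real.rpow_neg hr.le, Real.rpow_natCast,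
      neg_div_neg_eq, inv_pow]
    exact div_le_self (by positivity) hk'
  · refine (ae_restrict_iff' measurableSet_Ioi).2 (Filter.Eventually.of_forall fun t ht => ?_)
    exact Real.rpow_nonneg (hr.trans ht).le _

section OneSided

variable {n : ℕ} {A : ℝ} {ψ : Eu n → Eu n → Eu n → ℝ} {φ w : ℝ → ℝ} {c x : Eu n} {m : ℝ}
  {θ₁ θ₂ : Eu n → ℝ} {S : Set (Eu n)}

lemma BKernelCond.lintegral_ball_le_of_small (hψ : BKernelCond n A ψ φ w) (hn : 1 ≤ n)
    (hφ : IsMOC φ) (hw : IsMOC w) (hm : 0 < m) (hR : 32 * m ≤ ‖x - c‖) (hθ : Integrable θ₁)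
    (hmean : ∫ y, θ₁ y = 0) (hS : ∀ y ∉ S, θ₁ y = 0) (hSc : ∀ y ∈ S, ‖y - c‖ ≤ m / 2)
    {t : ℝ} (ht0 : 0 < t) (ht : t < ‖x - c‖ / 4) :
    ∫⁻ z in Metric.ball (0 : Eu n) t, ‖∫ y : Eu n × Eu n,
        ψ (t⁻¹ • (x + z)) (t⁻¹ • y.1) (t⁻¹ • y.2) * θ₁ y.1 * θ₂ y.2‖ₑ ≤
      ENNReal.ofReal (A * (t / (‖x - c‖ / 2)) ^ (2 * n) * w (t / (‖x - c‖ / 2)) *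
        φ (2 * m / ‖x - c‖) * t ^ n) * (volume (Metric.ball (0 : Eu n) 1) *
          (∫⁻ y, ‖θ₁ y‖ₑ) * ∫⁻ v, ‖θ₂ v‖ₑ) := by
  have hR0 : 0 < ‖x - c‖ := by linarith
  set M := A * (t / (‖x - c‖ / 2)) ^ (2 * n) * w (t / (‖x - c‖ / 2)) * φ (2 * m / ‖x - c‖)
    with hM
  have hM0 : 0 ≤ M := by
    have := hψ.nonneg hw
    have := hw.1 (t / (‖x - c‖ / 2)) (by positivity)
    have := hφ.1 (2 * m / ‖x - c‖) (by positivity)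
    positivity
  calc _ ≤ ∫⁻ z in Metric.ball (0 : Eu n) t,
        (∫⁻ y, ‖θ₁ y‖ₑ) * (ENNReal.ofReal M * ∫⁻ v, ‖θ₂ v‖ₑ) := by
        refine setLIntegral_mono measurable_const fun z hz => ?_
        rw [← lintegral_const_mul' _ _ ENNReal.ofReal_ne_top]
        refine enorm_integral_le_of_cancel
          (k := fun y v => ψ (t⁻¹ • (x + z)) (t⁻¹ • y) (t⁻¹ • v)) hθ hmean hS
          fun y hy y' hy' v => ?_
        refine hψ.enorm_sub_le_of_small hφ hw hm hR ht ?_ (hSc y hy) (hSc y' hy') v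
        rw [add_sub_cancel_left]
        simpa using hz
    _ = _ := by
        rw [setLIntegral_const, volume_ball_eq hn ht0.le, ENNReal.ofReal_mul hM0]
        ring

lemma BKernelCond.lintegral_ball_le_of_large (hψ : BKernelCond n A ψ φ w) (hn : 1 ≤ n)
    (hφ : IsMOC φ) (hw : IsMOC w) (hm : 0 < m) (hR : 32 * m ≤ ‖x - c‖) (hθ : Integrable θ₁)
    (hθ₂ : Integrable θ₂)
    (hmean : ∫ y, θ₁ y = 0) (hS : ∀ y ∉ S, θ₁ y = 0) (hSc : ∀ y ∈ S, ‖y - c‖ ≤ m / 2)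
    {t : ℝ} (ht : ‖x - c‖ / 4 ≤ t) :
    ∫⁻ z in Metric.ball (0 : Eu n) t, ‖∫ y : Eu n × Eu n,
        ψ (t⁻¹ • (x + z)) (t⁻¹ • y.1) (t⁻¹ • y.2) * θ₁ y.1 * θ₂ y.2‖ₑ ≤
      ENNReal.ofReal ((A + 1) * w 1 * φ (2 * m / ‖x - c‖) * (13 * t ^ n)) *
        (volume (Metric.ball (0 : Eu n) 1) * (∫⁻ y, ‖θ₁ y‖ₑ) * ∫⁻ v, ‖θ₂ v‖ₑ) := by
  have hR0 : 0 < ‖x - c‖ := by linarith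
  set M := (A + 1) * w 1 * φ (2 * m / ‖x - c‖) with hM
  have hM0 : 0 ≤ M := by
    have := hψ.nonneg hw
    have := hw.1 1 one_pos
    have := hφ.1 (2 * m / ‖x - c‖) (by positivity)
    positivity
  have hmeas : AEMeasurable (Function.uncurry fun (z v : Eu n) =>
      stepCount m (x + z - v) * ‖θ₂ v‖ₑ)
      ((volume.restrict (Metric.ball (0 : Eu n) t)).prod volume) := by
    refine AEMeasurable.mul ?_ ?_
    · exact ((measurable_stepCount m).comp (by fun_prop)).aemeasurable
    · exact hθ₂.aestronglyMeasurable.enorm.comp_snd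
  calc _ ≤ ∫⁻ z in Metric.ball (0 : Eu n) t, ((∫⁻ y, ‖θ₁ y‖ₑ) * ENNReal.ofReal M) *
          ∫⁻ v, stepCount m (x + z - v) * ‖θ₂ v‖ₑ := by
        refine setLIntegral_mono' Metric.isOpen_ball.measurableSet fun z hz => ?_
        rw [mul_assoc, ← lintegral_const_mul' _ _ ENNReal.ofReal_ne_top]
        simp_rw [← mul_assoc (ENNReal.ofReal M)]
        refine enorm_integral_le_of_cancel
          (k := fun y v => ψ (t⁻¹ • (x + z)) (t⁻¹ • y) (t⁻¹ • v)) hθ hmean hS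
          fun y hy y' hy' v => ?_
        refine hψ.enorm_sub_le_of_large hφ hw hm hR ht ?_ (hSc y hy) (hSc y' hy') v
        rw [add_sub_cancel_left]
        simpa using hz
    _ = ((∫⁻ y, ‖θ₁ y‖ₑ) * ENNReal.ofReal M) *
          ∫⁻ v, ∫⁻ z in Metric.ball (0 : Eu n) t, stepCount m (x + z - v) * ‖θ₂ v‖ₑ := by
        rw [lintegral_const_mul', lintegral_lintegral_swap hmeas]
        exact ENNReal.mul_ne_top hθ.2.ne ENNReal.ofReal_ne_top
    _ ≤ ((∫⁻ y, ‖θ₁ y‖ₑ) * ENNReal.ofReal M) *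
          ∫⁻ v, ENNReal.ofReal (13 * t ^ n) * volume (Metric.ball (0 : Eu n) 1) * ‖θ₂ v‖ₑ := by
        gcongr with v
        rw [lintegral_mul_const' _ _ enorm_ne_top]
        gcongr
        exact lintegral_stepCount_le hn hm (by linarith) x v
    _ = _ := by
        rw [lintegral_const_mul' _ _ (ENNReal.mul_ne_top ENNReal.ofReal_ne_top
          measure_ball_lt_top.ne), ENNReal.ofReal_mul hM0]
        ring

/-- The square function estimate using only the cancellation of `θ₁`. -/
lemma BKernelCond.lintegral_cone_le (hψ : BKernelCond n A ψ φ w) (hn : 1 ≤ n)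
    (hφ : IsMOC φ) (hw : IsMOC w) (hd : SatisfiesDini w) (hm : 0 < m) (hR : 32 * m ≤ ‖x - c‖)
    (hθ : Integrable θ₁) (hθ₂ : Integrable θ₂)
    (hmean : ∫ y, θ₁ y = 0) (hS : ∀ y ∉ S, θ₁ y = 0) (hSc : ∀ y ∈ S, ‖y - c‖ ≤ m / 2) :
    ∫⁻ p in {p : Eu n × ℝ | ‖p.1‖ < p.2}, ENNReal.ofReal (|(1 / p.2 ^ (2 * n)) *
        ∫ y : Eu n × Eu n, ψ (p.2⁻¹ • (x + p.1)) (p.2⁻¹ • y.1) (p.2⁻¹ • y.2) *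
          θ₁ y.1 * θ₂ y.2| / p.2 ^ (n + 1)) ≤
      ENNReal.ofReal (14 * 4 ^ (2 * n) * (A + 1) *
        (diniConst w / ‖x - c‖ ^ (2 * n) * φ (2 * m / ‖x - c‖))) *
        (volume (Metric.ball (0 : Eu n) 1) * (∫⁻ y, ‖θ₁ y‖ₑ) * ∫⁻ v, ‖θ₂ v‖ₑ) := by
  have hA := hψ.nonneg hw
  have hw1 := hw.1 1 one_pos
  have hwd := hw.diniConst_pos
  set R := ‖x - c‖ with hRdef
  have hR0 : 0 < R := by linarith
  set P := φ (2 * m / R) with hP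
  have hP0 : 0 < P := hφ.1 _ (by positivity)
  set W := volume (Metric.ball (0 : Eu n) 1) * (∫⁻ y, ‖θ₁ y‖ₑ) * ∫⁻ v, ‖θ₂ v‖ₑ with hW
  have hWtop : W ≠ ⊤ :=
    ENNReal.mul_ne_top (ENNReal.mul_ne_top measure_ball_lt_top.ne hθ.2.ne) hθ₂.2.ne
  refine (_root_.lintegral_cone_le _).trans ?_
  have hfix : ∀ t : ℝ, 0 < t → ∫⁻ z in Metric.ball (0 : Eu n) t,
      ENNReal.ofReal (|(1 / t ^ (2 * n)) *
        ∫ y : Eu n × Eu n, ψ (t⁻¹ • (x + z)) (t⁻¹ • y.1) (t⁻¹ • y.2) *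
          θ₁ y.1 * θ₂ y.2| / t ^ (n + 1)) = ENNReal.ofReal ((t ^ (2 * n) * t ^ (n + 1))⁻¹) *
      ∫⁻ z in Metric.ball (0 : Eu n) t, ‖∫ y : Eu n × Eu n,
        ψ (t⁻¹ • (x + z)) (t⁻¹ • y.1) (t⁻¹ • y.2) * θ₁ y.1 * θ₂ y.2‖ₑ := by
    intro t ht
    rw [← lintegral_const_mul' _ _ ENNReal.ofReal_ne_top]
    refine lintegral_congr fun z => ?_
    rw [Real.enorm_eq_ofReal_abs, ← ENNReal.ofReal_mul (by positivity), abs_mul,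
      abs_of_nonneg (show 0 ≤ 1 / t ^ (2 * n) by positivity)]
    congr 1
    field_simp
  have hsmall : ∀ t ∈ Ioo 0 (R / 4), ∫⁻ z in Metric.ball (0 : Eu n) t,
      ENNReal.ofReal (|(1 / t ^ (2 * n)) *
        ∫ y : Eu n × Eu n, ψ (t⁻¹ • (x + z)) (t⁻¹ • y.1) (t⁻¹ • y.2) *
          θ₁ y.1 * θ₂ y.2| / t ^ (n + 1)) ≤
      ENNReal.ofReal (A * (2 / R) ^ (2 * n) * P) * W *
        ENNReal.ofReal (w (t / (R / 2)) / t) := by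
    intro t ht
    have ht0 : 0 < t := ht.1
    have hwt := hw.1 (t / (R / 2)) (by positivity)
    rw [hfix t ht0]
    calc _ ≤ ENNReal.ofReal ((t ^ (2 * n) * t ^ (n + 1))⁻¹) *
          (ENNReal.ofReal (A * (t / (R / 2)) ^ (2 * n) * w (t / (R / 2)) * P * t ^ n) * W) := by
          gcongr
          exact hψ.lintegral_ball_le_of_small hn hφ hw hm hR hθ hmean hS hSc ht0 ht.2
      _ = _ := by
          rw [← mul_assoc, ← ENNReal.ofReal_mul (by positivity), mul_right_comm _ W,
            ← ENNReal.ofReal_mul (by positivity)]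
          congr 2
          rw [div_pow, div_pow, div_pow, pow_succ]
          field_simp
  have hlarge : ∀ t ∈ Ici (R / 4), ∫⁻ z in Metric.ball (0 : Eu n) t,
      ENNReal.ofReal (|(1 / t ^ (2 * n)) *
        ∫ y : Eu n × Eu n, ψ (t⁻¹ • (x + z)) (t⁻¹ • y.1) (t⁻¹ • y.2) *
          θ₁ y.1 * θ₂ y.2| / t ^ (n + 1)) ≤
      ENNReal.ofReal (13 * (A + 1) * w 1 * P) * W *
        ENNReal.ofReal ((t ^ (2 * n + 1))⁻¹) := by
    intro t ht
    have ht' : R / 4 ≤ t := ht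
    have ht0 : 0 < t := by linarith
    rw [hfix t ht0]
    calc _ ≤ ENNReal.ofReal ((t ^ (2 * n) * t ^ (n + 1))⁻¹) *
          (ENNReal.ofReal ((A + 1) * w 1 * P * (13 * t ^ n)) * W) := by
          gcongr
          exact hψ.lintegral_ball_le_of_large hn hφ hw hm hR hθ hθ₂ hmean hS hSc ht'
      _ = _ := by
          rw [← mul_assoc, ← ENNReal.ofReal_mul (by positivity), mul_right_comm _ W,
            ← ENNReal.ofReal_mul (by positivity)]
          congr 2
          rw [pow_succ, pow_succ]
          field_simp
  rw [← Ioo_union_Ici_eq_Ioi (show (0 : ℝ) < R / 4 by positivity)]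
  refine (lintegral_union_le _ _ _).trans ?_
  calc _ ≤ (∫⁻ t in Ioo 0 (R / 4), ENNReal.ofReal (A * (2 / R) ^ (2 * n) * P) * W *
            ENNReal.ofReal (w (t / (R / 2)) / t)) +
          ∫⁻ t in Ici (R / 4), ENNReal.ofReal (13 * (A + 1) * w 1 * P) * W *
            ENNReal.ofReal ((t ^ (2 * n + 1))⁻¹) :=
        add_le_add (setLIntegral_mono' measurableSet_Ioo hsmall)
          (setLIntegral_mono' measurableSet_Ici hlarge)
    _ ≤ ENNReal.ofReal (A * (2 / R) ^ (2 * n) * P) * W * ENNReal.ofReal (diniConst w) +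
        ENNReal.ofReal (13 * (A + 1) * w 1 * P) * W *
          ENNReal.ofReal (((R / 4)⁻¹) ^ (2 * n)) := by
        rw [lintegral_const_mul' _ _ (ENNReal.mul_ne_top ENNReal.ofReal_ne_top hWtop),
          lintegral_const_mul' _ _ (ENNReal.mul_ne_top ENNReal.ofReal_ne_top hWtop)]
        gcongr
        · exact lintegral_dini_le hw hd hR0
        · exact lintegral_Ici_inv_pow_le (by omega) (by positivity)
    _ = ENNReal.ofReal (A * (2 / R) ^ (2 * n) * P * diniConst w +
          13 * (A + 1) * w 1 * P * ((R / 4)⁻¹) ^ (2 * n)) * W := by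
        rw [mul_right_comm _ W, ← ENNReal.ofReal_mul (by positivity), mul_right_comm _ W,
          ← ENNReal.ofReal_mul (by positivity), ← add_mul,
          ← ENNReal.ofReal_add (by positivity) (by positivity)]
    _ ≤ _ := by
        gcongr
        have hI : w 1 ≤ diniConst w := le_add_of_nonneg_left
          (setIntegral_nonneg measurableSet_Ioc fun t ht => (div_pos (hw.1 t ht.1) ht.1).le)
        calc _ ≤ (A + 1) * (4 / R) ^ (2 * n) * P * diniConst w +
              13 * (A + 1) * diniConst w * P * ((R / 4)⁻¹) ^ (2 * n) := by
              gcongr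
              · linarith
              · norm_num
          _ = _ := by
              rw [inv_div, div_pow]
              ring

/-- The one-sided estimate in terms of real integrals. -/
lemma BKernelCond.integral_cone_le (hψ : BKernelCond n A ψ φ w) (hn : 1 ≤ n)
    (hφ : IsMOC φ) (hw : IsMOC w) (hd : SatisfiesDini w) (hm : 0 < m) (hR : 32 * m ≤ ‖x - c‖)
    (hθ : Integrable θ₁) (hθ₂ : Integrable θ₂)
    (hmean : ∫ y, θ₁ y = 0) (hS : ∀ y ∉ S, θ₁ y = 0) (hSc : ∀ y ∈ S, ‖y - c‖ ≤ m / 2) :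
    ∫ p in {p : Eu n × ℝ | ‖p.1‖ < p.2}, (|(1 / p.2 ^ (2 * n)) *
        ∫ y : Eu n × Eu n, ψ (p.2⁻¹ • (x + p.1)) (p.2⁻¹ • y.1) (p.2⁻¹ • y.2) *
          θ₁ y.1 * θ₂ y.2| / p.2 ^ (n + 1)) ≤
      14 * 4 ^ (2 * n) * (A + 1) * (volume (Metric.ball (0 : Eu n) 1)).toReal *
        ((diniConst w / ‖x - c‖ ^ (2 * n) * φ (2 * m / ‖x - c‖)) *
          ((∫ y, |θ₁ y|) * ∫ y, |θ₂ y|)) := by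
  have h := hψ.lintegral_cone_le hn hφ hw hd hm hR hθ hθ₂ hmean hS hSc
  have hR0 : 0 < ‖x - c‖ := by linarith
  have hA := hψ.nonneg hw
  have hwd := hw.diniConst_pos
  have hP0 : 0 < φ (2 * m / ‖x - c‖) := hφ.1 _ (by positivity)
  have hL : ∀ θ : Eu n → ℝ, Integrable θ → (∫⁻ y, ‖θ y‖ₑ).toReal = ∫ y, |θ y| := by
    intro θ hi
    exact (integral_norm_eq_lintegral_enorm hi.aestronglyMeasurable).symm
  have hWtop : volume (Metric.ball (0 : Eu n) 1) * (∫⁻ y, ‖θ₁ y‖ₑ) * ∫⁻ v, ‖θ₂ v‖ₑ ≠ ⊤ :=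
    ENNReal.mul_ne_top (ENNReal.mul_ne_top measure_ball_lt_top.ne hθ.2.ne) hθ₂.2.ne
  refine (Real.le_norm_self _).trans ((norm_integral_le_lintegral_norm _).trans ?_)
  have hmono := ENNReal.toReal_mono (ENNReal.mul_ne_top ENNReal.ofReal_ne_top hWtop) h
  have hS' : MeasurableSet {p : Eu n × ℝ | ‖p.1‖ < p.2} :=
    measurableSet_lt measurable_fst.norm measurable_snd
  refine le_trans (le_of_eq ?_) (hmono.trans (le_of_eq ?_))
  · congr 1
    refine setLIntegral_congr_fun hS' fun p hp => ?_
    have hp0 : 0 < p.2 := (norm_nonneg p.1).trans_lt hp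
    beta_reduce
    rw [Real.norm_of_nonneg (by positivity)]
  · rw [ENNReal.toReal_mul, ENNReal.toReal_mul, ENNReal.toReal_mul, hL _ hθ, hL _ hθ₂,
      ENNReal.toReal_ofReal (by positivity)]
    ring

end OneSided

lemma norm_sub_le_of_mem_ccube {n : ℕ} {c y : Eu n} {l : ℝ} (hl : 0 ≤ l) (hy : y ∈ ccube n c l) :
    ‖y - c‖ ≤ √n * l / 2 := by
  rw [EuclideanSpace.norm_eq, Real.sqrt_le_left (by positivity)]
  calc ∑ i, ‖(y - c) i‖ ^ 2 ≤ ∑ _i : Fin n, (l / 2) ^ 2 := by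
        refine Finset.sum_le_sum fun i _ => ?_
        have := hy i
        rw [PiLp.sub_apply, Real.norm_eq_abs]
        gcongr
    _ = (√n * l / 2) ^ 2 := by
        rw [div_pow (√n * l), mul_pow, Real.sq_sqrt (by positivity)]
        simp
        ring

lemma le_norm_sub_of_notMem_ccube {n : ℕ} {c x : Eu n} {l : ℝ} (hl : 0 ≤ l)
    (hx : x ∉ ccube n c (64 * n * l)) : 32 * (√n * l) ≤ ‖x - c‖ := by
  simp only [ccube, mem_ofPred_eq, not_forall, not_le] at hx
  obtain ⟨i, hi⟩ := hx
  have hn : (1 : ℝ) ≤ n := by exact_mod_cast i.pos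
  have h1 : |x i - c i| ≤ ‖x - c‖ := by
    have := PiLp.norm_apply_le (x - c) i
    rwa [PiLp.sub_apply, Real.norm_eq_abs] at this
  have h2 : √n ≤ n := Real.sqrt_le_self_iff.2 (.inr hn)
  have h3 : √n * l ≤ n * l := by gcongr
  linarith

lemma le_mul_sqrt_mul_sqrt {X K a b N : ℝ} (hK : 0 ≤ K) (ha : 0 ≤ a) (hb : 0 ≤ b) (hN : 0 ≤ N)
    (h₁ : X ≤ K * (a * N)) (h₂ : X ≤ K * (b * N)) : X ≤ K * (√a * √b * N) := by
  rcases le_total a b with h | h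
  · refine h₁.trans ?_
    nth_rw 1 [← Real.mul_self_sqrt ha]
    gcongr
  · refine h₂.trans ?_
    nth_rw 1 [← Real.mul_self_sqrt hb]
    gcongr

/-- for mean-zero `θ₁, θ₂` supported in cubes `Q₁, Q₂`, and
`x ∉ 64nQ₁ ∪ 64nQ₂`,
`∬_{Γ₁(0)} |t^{−2n} ∫ ψ((x+z)/t, y₁/t, y₂/t) θ₁(y₁)θ₂(y₂) dy⃗| dz dt/t^{n+1}
  ≤ C ∏_k (A^{(k)}(x) + B^{(k)}(x)) ‖θ_k‖_{L¹}`, with `C` depending only on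
`n` and `A`. -/
theorem stmt19 (n : ℕ) (hn : 1 ≤ n) (A : ℝ) :
    ∃ C > 0, ∀ (ψ : Eu n → Eu n → Eu n → ℝ) (φ w : ℝ → ℝ),
      IsMOC φ → IsMOC w → SatisfiesDini w → BKernelCond n A ψ φ w →
      ∀ (c : Fin 2 → Eu n) (l : Fin 2 → ℝ), (∀ k, 0 < l k) →
      ∀ θ : Fin 2 → Eu n → ℝ, (∀ k, Integrable (θ k) volume) →
        (∀ k, ∀ y, y ∉ ccube n (c k) (l k) → θ k y = 0) →
        (∀ k, (∫ y : Eu n, θ k y) = 0) →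
      ∀ x : Eu n, (∀ k, x ∉ ccube n (c k) (64 * n * l k)) →
        (∫ p in {p : Eu n × ℝ | ‖p.1‖ < p.2},
          |(1 / p.2 ^ (2 * n)) *
              ∫ y : Eu n × Eu n,
                ψ (p.2⁻¹ • (x + p.1)) (p.2⁻¹ • y.1) (p.2⁻¹ • y.2) *
                  θ 0 y.1 * θ 1 y.2| / p.2 ^ (n + 1)) ≤
          C * ∏ k : Fin 2,
            ((Real.sqrt (diniConst w / ‖x - c k‖ ^ (2 * n) *
                φ (2 * Real.sqrt n * l k / ‖x - c k‖)) +
              Real.sqrt (∫ t in Set.Ioi (l k),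
                l k ^ n * w (t / (t + ‖x - c k‖)) /
                  ((t + ‖x - c k‖) ^ (2 * n) * t ^ (n + 1)))) *
              ∫ y : Eu n, |θ k y|) := by
  set V := (volume (Metric.ball (0 : Eu n) 1)).toReal with hV
  refine ⟨14 * 4 ^ (2 * n) * (|A| + 1) * V + 1, by positivity, ?_⟩
  intro ψ φ w hφ hw hd hψ c l hl θ hθ hsupp hmean x hx
  have hA := hψ.nonneg hw
  have hn0 : (0 : ℝ) < n := by exact_mod_cast hn
  have hwd := hw.diniConst_pos
  have hm : ∀ k, 0 < √n * l k := fun k => mul_pos (Real.sqrt_pos.2 hn0) (hl k)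
  have hR : ∀ k, 32 * (√n * l k) ≤ ‖x - c k‖ := fun k =>
    le_norm_sub_of_notMem_ccube (hl k).le (hx k)
  have hS : ∀ k, ∀ y ∈ ccube n (c k) (l k), ‖y - c k‖ ≤ √n * l k / 2 := fun k y hy =>
    norm_sub_le_of_mem_ccube (hl k).le hy
  have h0 := hψ.integral_cone_le hn hφ hw hd (hm 0) (hR 0) (hθ 0) (hθ 1) (hmean 0) (hsupp 0) (hS 0)
  have h1 := hψ.swap.integral_cone_le hn hφ hw hd (hm 1) (hR 1) (hθ 1) (hθ 0) (hmean 1) (hsupp 1)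
    (hS 1)
  have hswap : ∀ p : Eu n × ℝ, ∫ y : Eu n × Eu n,
      ψ (p.2⁻¹ • (x + p.1)) (p.2⁻¹ • y.2) (p.2⁻¹ • y.1) * θ 1 y.1 * θ 0 y.2 =
      ∫ y : Eu n × Eu n,
        ψ (p.2⁻¹ • (x + p.1)) (p.2⁻¹ • y.1) (p.2⁻¹ • y.2) * θ 0 y.1 * θ 1 y.2 := by
    intro p
    rw [Measure.volume_eq_prod, ← integral_prod_swap]
    simp only [Prod.fst_swap, Prod.snd_swap, mul_right_comm]
  simp only [hswap] at h1
  rw [← hV] at h0 h1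
  rw [mul_comm (∫ y, |θ 1 y|)] at h1
  have ha : ∀ k, 0 ≤ diniConst w / ‖x - c k‖ ^ (2 * n) * φ (2 * (√n * l k) / ‖x - c k‖) := by
    intro k
    have hRk : 0 < ‖x - c k‖ := by linarith [hm k, hR k]
    have := hφ.1 (2 * (√n * l k) / ‖x - c k‖) (div_pos (mul_pos two_pos (hm k)) hRk)
    positivity
  have hN : ∀ k, 0 ≤ ∫ y, |θ k y| := fun k => integral_nonneg fun y => abs_nonneg _
  refine (le_mul_sqrt_mul_sqrt (by positivity) (ha 0) (ha 1) (mul_nonneg (hN 0) (hN 1)) h0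
    h1).trans ?_
  rw [Fin.prod_univ_two, mul_mul_mul_comm (√_ + √_)]
  simp only [mul_assoc (2 : ℝ) √n]
  have := hN 0
  have := hN 1
  gcongr
  · exact (mul_le_mul_of_nonneg_right (by gcongr; exact le_abs_self A) ENNReal.toReal_nonneg).trans
      (le_add_of_nonneg_right zero_le_one)
  · exact le_add_of_nonneg_right (Real.sqrt_nonneg _)
  · exact le_add_of_nonneg_right (Real.sqrt_nonneg _)

end
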